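/- arXiv:2211.06109 — 3 statements merged into one kernel-verified Lean document; each statement's English description precedes it below -/
import Mathlib

section
/- (Soundness of 4PATH) Let G be a digraph and v ∈ V(G) a vertex with N(v) = N_bi(v) = {a,b,c,d} (four distinct vertices) and E(G[N(v)]) = {(a,b),(b,a),(b,c),(c,b),(c,d),(d,c)}, and suppose there is no uncovered path between any pair of vertices from {a,c}, {a,d}, {d,b}. Let G' = G − v + {(a,c),(c,a),(a,d),(d,a),(b,d),(d,b)} + {a,b}×N_succ(d) + N_pre(d)×{a,b} + {c,d}×N_succ(a) + N_pre(a)×{c,d}. Then DFVS(G) = DFVS(G'). -/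
namespace DFVSP

open scoped Classical

noncomputable section

variable {V : Type*} [Fintype V] [DecidableEq V]

/-- A digraph on the (finite) vertex set `V` is given by its finite set of arcs. -/
abbrev Dgraph (V : Type*) := Finset (V × V)

/-- `p` is a path in `G`: a list of vertices where consecutive vertices are joined by arcs. -/
def IsPath (G : Dgraph V) (p : List V) : Prop :=
  List.Chain' (fun a b => (a, b) ∈ G) p

/-- `p` is a path in `G` that starts at `a` and ends at `b`. -/
def IsPathFrom (G : Dgraph V) (a b : V) (p : List V) : Prop :=
  IsPath G p ∧ p.head? = some a ∧ p.getLast? = some b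

/-- `p` is a cycle in `G`: a path `v₁,…,vₙ` with `n ≥ 2` and `v₁ = vₙ`. -/
def IsCycle (G : Dgraph V) (p : List V) : Prop :=
  IsPath G p ∧ 2 ≤ p.length ∧ p.head? = p.getLast?

/-- `D` is a directed feedback vertex set of `G`: every cycle contains a vertex of `D`. -/
def IsDFVS (G : Dgraph V) (D : Finset V) : Prop :=
  ∀ p : List V, IsCycle G p → ∃ x ∈ p, x ∈ D

/-- The minimum cardinality of a DFVS of `G`. -/
def dfvsNum (G : Dgraph V) : ℕ :=
  sInf {n | ∃ D : Finset V, IsDFVS G D ∧ D.card = n}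

/-- `D` is a DFVS of `G` of minimum cardinality. -/
def IsMinDFVS (G : Dgraph V) (D : Finset V) : Prop :=
  IsDFVS G D ∧ ∀ D' : Finset V, IsDFVS G D' → D.card ≤ D'.card

/-- The predecessors of `v` in `G`. -/
def Npre (G : Dgraph V) (v : V) : Finset V := Finset.univ.filter fun p => (p, v) ∈ G

/-- The successors of `v` in `G`. -/
def Nsucc (G : Dgraph V) (v : V) : Finset V := Finset.univ.filter fun s => (v, s) ∈ G

/-- The bi-edge neighbours of `v` in `G`. -/
def Nbi (G : Dgraph V) (v : V) : Finset V := Npre G v ∩ Nsucc G v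

/-- The neighbours of `v` in `G`. -/
def Nbhd (G : Dgraph V) (v : V) : Finset V := Npre G v ∪ Nsucc G v

/-- The consecutive pairs of vertices along a list. -/
def consecutivePairs (p : List V) : List (V × V) := p.zip p.tail

/-- The path `p` uses a bi-edge of `G`. -/
def UsesBiEdge (G : Dgraph V) (p : List V) : Prop :=
  ∃ q ∈ consecutivePairs p, (q.1, q.2) ∈ G ∧ (q.2, q.1) ∈ G

/-- A path (or cycle) `p` is uncovered in `G` if there is no cycle whose vertex set is a
proper subset of the vertex set of `p`. -/
def Uncovered (G : Dgraph V) (p : List V) : Prop :=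
  ¬ ∃ q : List V, IsCycle G q ∧ q.toFinset ⊂ p.toFinset

/-- `G − v`: delete the vertex `v` together with all incident arcs. -/
def deleteVertex (G : Dgraph V) (v : V) : Dgraph V :=
  G.filter fun a => a.1 ≠ v ∧ a.2 ≠ v

/-- `G[A]`: the subdigraph induced by the vertex set `A`. -/
def induce (G : Dgraph V) (A : Finset V) : Dgraph V :=
  G.filter fun a => a.1 ∈ A ∧ a.2 ∈ A

/-- The exclusion `G ∘ v`: delete `v` and add an arc `(p, s)` for every predecessor `p`
and successor `s` of `v`. -/
def exclude (G : Dgraph V) (v : V) : Dgraph V :=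
  deleteVertex G v ∪ Npre G v ×ˢ Nsucc G v

/-- A diclique: all pairs of distinct vertices of `S` are joined by bi-edges. -/
def IsDiclique (G : Dgraph V) (S : Finset V) : Prop :=
  ∀ u ∈ S, ∀ w ∈ S, u ≠ w → (u, w) ∈ G ∧ (w, u) ∈ G

/-- There is no uncovered path (in either direction) between `x` and `y`. -/
def NoUncoveredPathBetween (G : Dgraph V) (x y : V) : Prop :=
  ¬ ∃ p : List V, (IsPathFrom G x y p ∨ IsPathFrom G y x p) ∧ Uncovered G p

/-- The digraph obtained from `G` by the 4PATH reduction on `v` with `N(v) = {a,b,c,d}`: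
`G − v + {(a,c),(c,a),(a,d),(d,a),(b,d),(d,b)} + {a,b}×N_succ(d) + N_pre(d)×{a,b}
 + {c,d}×N_succ(a) + N_pre(a)×{c,d}`. -/
def fourPathGraph (G : Dgraph V) (v a b c d : V) : Dgraph V :=
  (G ∪ ({(a, c), (c, a), (a, d), (d, a), (b, d), (d, b)} : Finset (V × V))
     ∪ ({a, b} : Finset V) ×ˢ Nsucc G d ∪ Npre G d ×ˢ ({a, b} : Finset V)
     ∪ ({c, d} : Finset V) ×ˢ Nsucc G a ∪ Npre G a ×ˢ ({c, d} : Finset V)).filter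
    fun x => x.1 ≠ v ∧ x.2 ≠ v

set_option linter.unusedSectionVars false

/-- The arc relation of `G` restricted to the vertices outside `D`. -/
def ArcOff (G : Dgraph V) (D : Finset V) (u w : V) : Prop :=
  (u, w) ∈ G ∧ u ∉ D ∧ w ∉ D

lemma transGen_arcOff_of_path {G : Dgraph V} {D : Finset V} (l : List V) :
    ∀ (u u' w : V), IsPath G (u :: u' :: l) → (u :: u' :: l).getLast? = some w →
      (∀ z ∈ u :: u' :: l, z ∉ D) → Relation.TransGen (ArcOff G D) u w := by
  induction l with
  | nil =>
    intro u u' w hp hl hD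
    have hp' := (List.isChain_cons_cons (R := fun a b => (a, b) ∈ G)).1 hp
    simp only [List.getLast?_cons_cons, List.getLast?_singleton, Option.some.injEq] at hl
    subst hl
    exact .single ⟨hp'.1, hD _ (by simp), hD _ (by simp)⟩
  | cons t l ih =>
    intro u u' w hp hl hD
    have hp' := (List.isChain_cons_cons (R := fun a b => (a, b) ∈ G)).1 hp
    rw [List.getLast?_cons_cons] at hl
    exact .head ⟨hp'.1, hD _ (by simp), hD _ (by simp)⟩
      (ih u' t w hp'.2 hl fun z hz => hD z (List.mem_cons_of_mem _ hz))

lemma exists_path_of_transGen_arcOff {G : Dgraph V} {D : Finset V} {u w : V}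
    (h : Relation.TransGen (ArcOff G D) u w) :
    ∃ p, IsPathFrom G u w p ∧ 2 ≤ p.length ∧ ∀ z ∈ p, z ∉ D := by
  induction h using Relation.TransGen.head_induction_on with
  | single h =>
    obtain ⟨hG, hu, hw⟩ := h
    exact ⟨[_, w], ⟨List.isChain_pair.2 hG, rfl, rfl⟩, by simp, by simp [hu, hw]⟩
  | @head u' t h _ ih =>
    obtain ⟨hG, hu, -⟩ := h
    obtain ⟨p, ⟨hp, hh, hl⟩, hlen, hD⟩ := ih
    match p, hh with
    | z :: p, hh =>
      obtain rfl : z = t := by simpa using hh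
      refine ⟨u' :: z :: p, ⟨?_, rfl, ?_⟩, by simp, ?_⟩
      · exact List.isChain_cons_cons.2 ⟨hG, hp⟩
      · rw [List.getLast?_cons_cons]; exact hl
      · intro y hy
        rcases List.mem_cons.1 hy with rfl | hy
        · exact hu
        · exact hD y hy

lemma isDFVS_iff_acyclic {G : Dgraph V} {D : Finset V} :
    IsDFVS G D ↔ ∀ u, ¬ Relation.TransGen (ArcOff G D) u u := by
  constructor
  · intro h u hu
    obtain ⟨p, ⟨hp, hh, hl⟩, hlen, hD⟩ := exists_path_of_transGen_arcOff hu
    obtain ⟨x, hx, hxD⟩ := h p ⟨hp, hlen, hh.trans hl.symm⟩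
    exact hD x hx hxD
  · rintro h p ⟨hp, hlen, heq⟩
    by_contra! hD
    match p, hlen with
    | u :: u' :: l, _ => exact h u (transGen_arcOff_of_path l u u' u hp heq.symm hD)

lemma NoUncoveredPathBetween.symm {G : Dgraph V} {x y : V} (h : NoUncoveredPathBetween G x y) :
    NoUncoveredPathBetween G y x :=
  fun ⟨p, hp, hu⟩ => h ⟨p, hp.symm, hu⟩

lemma IsDFVS.not_transGen {G : Dgraph V} {D : Finset V} {x y : V} (hD : IsDFVS G D)
    (h : NoUncoveredPathBetween G x y) : ¬ Relation.TransGen (ArcOff G D) x y := by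
  intro ht
  obtain ⟨p, hp, -, hpD⟩ := exists_path_of_transGen_arcOff ht
  refine h ⟨p, .inl hp, ?_⟩
  rintro ⟨q, hq, hqp⟩
  obtain ⟨z, hz, hzD⟩ := hD q hq
  exact hpD z (List.mem_toFinset.1 (hqp.1 (List.mem_toFinset.2 hz))) hzD

lemma IsDFVS.of_arcs {G H : Dgraph V} {D E : Finset V} (hD : IsDFVS G D)
    (h : ∀ u w, (u, w) ∈ H → u ∉ E → w ∉ E → (u, w) ∈ G ∧ u ∉ D ∧ w ∉ D) : IsDFVS H E := by
  rw [isDFVS_iff_acyclic] at hD ⊢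
  exact fun u hu => hD u (Relation.TransGen.mono
    (fun s t (hst : ArcOff H E s t) => h s t hst.1 hst.2.1 hst.2.2) u u hu)

lemma IsDFVS.mem_or_mem {G : Dgraph V} {D : Finset V} (hD : IsDFVS G D) {u w : V}
    (h₁ : (u, w) ∈ G) (h₂ : (w, u) ∈ G) : u ∈ D ∨ w ∈ D := by
  by_contra! h
  exact isDFVS_iff_acyclic.1 hD u (.tail (.single ⟨h₁, h.1, h.2⟩) ⟨h₂, h.2, h.1⟩)

lemma dfvsNum_le_of_forall {G H : Dgraph V}
    (h : ∀ D, IsDFVS G D → ∃ E, IsDFVS H E ∧ E.card ≤ D.card) : dfvsNum H ≤ dfvsNum G := by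
  have hne : {n | ∃ D : Finset V, IsDFVS G D ∧ D.card = n}.Nonempty :=
    ⟨_, Finset.univ, fun p hp => (List.exists_mem_of_length_pos
      (by have := hp.2.1; omega)).imp fun x hx => ⟨hx, Finset.mem_univ x⟩, rfl⟩
  obtain ⟨D, hD, hcard⟩ := Nat.sInf_mem hne
  obtain ⟨E, hE, hle⟩ := h D hD
  have hmem : E.card ∈ {n | ∃ D : Finset V, IsDFVS H D ∧ D.card = n} := ⟨E, hE, rfl⟩
  exact (Nat.sInf_le hmem).trans (hle.trans hcard.le)

/-- If `H` arises from `G` outside `S` by redirecting the arcs at `y` to `x`, and no path of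
`G` outside `S` joins `x` and `y`, then `S ∪ {y}` is a DFVS of `H` when `S` is one of `G`. -/
lemma IsDFVS.insert_of_merge {G H : Dgraph V} {S : Finset V} {x y : V}
    (hS : IsDFVS G S) (hxS : x ∉ S) (hyS : y ∉ S) (hxy : NoUncoveredPathBetween G x y)
    (h : ∀ u w, (u, w) ∈ H → u ∉ insert y S → w ∉ insert y S →
      (u, w) ∈ G ∨ (u = x ∧ (y, w) ∈ G) ∨ (w = x ∧ (u, y) ∈ G)) :
    IsDFVS H (insert y S) := by
  set φ : V → V := fun u => if u = y then x else u with hφ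
  let P : V → V → Prop := fun u w =>
    ∃ u' w', φ u' = u ∧ φ w' = w ∧ Relation.TransGen (ArcOff G S) u' w'
  have fiber : ∀ s t, φ s = φ t → s = t ∨ (φ s = x ∧ (s = x ∨ s = y) ∧ (t = x ∨ t = y)) := by
    intro s t hst
    simp only [hφ] at hst ⊢
    grind
  have hacyc := isDFVS_iff_acyclic.1 hS
  have arc : ∀ u w, ArcOff H (insert y S) u w → P u w := by
    rintro u w ⟨hH, hu, hw⟩
    have hu' : u ≠ y ∧ u ∉ S := by simpa using hu
    have hw' : w ≠ y ∧ w ∉ S := by simpa using hw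
    rcases h u w hH hu hw with hG | ⟨rfl, hG⟩ | ⟨rfl, hG⟩
    · exact ⟨u, w, by simp [hφ, hu'.1], by simp [hφ, hw'.1], .single ⟨hG, hu'.2, hw'.2⟩⟩
    · exact ⟨y, w, by simp [hφ], by simp [hφ, hw'.1], .single ⟨hG, hyS, hw'.2⟩⟩
    · exact ⟨u, y, by simp [hφ, hu'.1], by simp [hφ], .single ⟨hG, hu'.2, hyS⟩⟩
  have comp : ∀ u w z, P u w → P w z → P u z ∨ (P u x ∧ P x z) := by
    rintro u w z ⟨u', w', hu, hw, p⟩ ⟨w'', z', hw', hz, q⟩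
    rcases fiber w' w'' (hw.trans hw'.symm) with rfl | ⟨hx, -, -⟩
    · exact .inl ⟨u', z', hu, hz, p.trans q⟩
    · obtain rfl : w = x := hw.symm.trans hx
      exact .inr ⟨⟨u', w', hu, hw, p⟩, ⟨w'', z', hw', hz, q⟩⟩
  have hPxx : ¬ P x x := by
    rintro ⟨s, t, hs, ht, p⟩
    rcases fiber s t (hs.trans ht.symm) with rfl | ⟨-, rfl | rfl, rfl | rfl⟩
    · exact hacyc _ p
    · exact hacyc _ p
    · exact hS.not_transGen hxy p
    · exact hS.not_transGen hxy.symm p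
    · exact hacyc _ p
  have walk : ∀ u w, Relation.TransGen (ArcOff H (insert y S)) u w →
      P u w ∨ (P u x ∧ P x w) := by
    intro u w huw
    induction huw with
    | single h => exact .inl (arc _ _ h)
    | tail _ h ih =>
      rcases ih with ih | ⟨ih₁, ih₂⟩
      · exact comp _ _ _ ih (arc _ _ h)
      · rcases comp _ _ _ ih₂ (arc _ _ h) with h | h
        · exact .inr ⟨ih₁, h⟩
        · exact .inr ⟨ih₁, h.2⟩
  refine isDFVS_iff_acyclic.2 fun u hu => ?_
  rcases walk u u hu with ⟨s, t, hs, ht, p⟩ | ⟨h₁, h₂⟩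
  · rcases fiber s t (hs.trans ht.symm) with rfl | ⟨hx, -, -⟩
    · exact hacyc _ p
    · obtain rfl : u = x := hs.symm.trans hx
      exact hPxx ⟨s, t, hs, ht, p⟩
  · rcases comp _ _ _ h₂ h₁ with h | h
    · exact hPxx h
    · exact hPxx h.1

/-- If redirecting arcs at `y` to `x` maps the arcs of `G` outside `S` to arcs of `H`, and
`S ∪ {y}` is a DFVS of `H`, then `S` is a DFVS of `G`. -/
lemma IsDFVS.of_insert_of_merge {G H : Dgraph V} {S : Finset V} {x y : V}
    (hH : IsDFVS H (insert y S)) (hxS : x ∉ S) (hxy : x ≠ y)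
    (h : ∀ u w, (u, w) ∈ G → u ∉ S → w ∉ S →
      ((if u = y then x else u), (if w = y then x else w)) ∈ H) :
    IsDFVS G S := by
  rw [isDFVS_iff_acyclic] at hH ⊢
  intro u hu
  refine hH (if u = y then x else u) (hu.lift (fun u => if u = y then x else u) ?_)
  rintro s t ⟨hst, hs, ht⟩
  refine ⟨h s t hst hs ht, ?_, ?_⟩ <;> dsimp only <;> split_ifs <;> simp_all

lemma mem_fourPathGraph {G : Dgraph V} {v a b c d u w : V} :
    (u, w) ∈ fourPathGraph G v a b c d ↔
      ((u, w) ∈ G ∨ ((u = a ∧ w = c) ∨ (u = c ∧ w = a) ∨ (u = a ∧ w = d) ∨ (u = d ∧ w = a) ∨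
          (u = b ∧ w = d) ∨ (u = d ∧ w = b)) ∨
        ((u = a ∨ u = b) ∧ (d, w) ∈ G) ∨ ((u, d) ∈ G ∧ (w = a ∨ w = b)) ∨
        ((u = c ∨ u = d) ∧ (a, w) ∈ G) ∨ ((u, a) ∈ G ∧ (w = c ∨ w = d))) ∧ u ≠ v ∧ w ≠ v := by
  simp only [fourPathGraph, Npre, Nsucc, Finset.mem_filter, Finset.mem_union, Finset.mem_insert,
    Finset.mem_singleton, Finset.mem_product, Finset.mem_univ, true_and, Prod.mk.injEq, or_assoc,
    ne_eq]

lemma IsDFVS.fourPathGraph_of_subset {G : Dgraph V} {v a b c d : V} {D E : Finset V}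
    (hD : IsDFVS G D) (hDE : D ⊆ E) (ha : a ∈ E) (hb : b ∈ E) (hc : c ∈ E) (hd : d ∈ E) :
    IsDFVS (fourPathGraph G v a b c d) E := by
  refine hD.of_arcs fun u w huw hu hw => ⟨?_, fun h => hu (hDE h), fun h => hw (hDE h)⟩
  have hne : ∀ t ∉ E, t ≠ a ∧ t ≠ b ∧ t ≠ c ∧ t ≠ d := fun t ht =>
    ⟨(ne_of_mem_of_not_mem ha ht).symm, (ne_of_mem_of_not_mem hb ht).symm,
      (ne_of_mem_of_not_mem hc ht).symm, (ne_of_mem_of_not_mem hd ht).symm⟩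
  simpa [hne u hu, hne w hw] using (mem_fourPathGraph.1 huw).1

/-- The vertex `v` has exactly the four bi-edge neighbours `a`, `b`, `c`, `d`, which induce the
bidirected path `a - b - c - d`. -/
structure IsFourPath (G : Dgraph V) (v a b c d : V) : Prop where
  ne : (a ≠ b ∧ a ≠ c ∧ a ≠ d ∧ b ≠ c ∧ b ≠ d ∧ c ≠ d) ∧ a ≠ v ∧ b ≠ v ∧ c ≠ v ∧ d ≠ v
  bi : ∀ u, (u = a ∨ u = b ∨ u = c ∨ u = d) → (u, v) ∈ G ∧ (v, u) ∈ G
  eq_of_arc : ∀ u, (u, v) ∈ G ∨ (v, u) ∈ G → u = a ∨ u = b ∨ u = c ∨ u = d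
  arc : ((a, b) ∈ G ∧ (b, a) ∈ G) ∧ ((b, c) ∈ G ∧ (c, b) ∈ G) ∧ (c, d) ∈ G ∧ (d, c) ∈ G
  not_arc : ((a, c) ∉ G ∧ (c, a) ∉ G) ∧ ((a, d) ∉ G ∧ (d, a) ∉ G) ∧ (b, d) ∉ G ∧ (d, b) ∉ G
  not_loop : (a, a) ∉ G ∧ (b, b) ∉ G ∧ (c, c) ∉ G ∧ (d, d) ∉ G

lemma IsFourPath.dfvsNum_le {G : Dgraph V} {v a b c d : V} (h : IsFourPath G v a b c d) :
    dfvsNum G ≤ dfvsNum (fourPathGraph G v a b c d) := by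
  obtain ⟨⟨⟨nab, nac, nad, nbc, nbd, ncd⟩, nva, nvb, nvc, nvd⟩, hbi, hnb, ⟨gab, gbc, gcd⟩,
    ⟨gac, gad, gbd⟩, gloop⟩ := h
  refine dfvsNum_le_of_forall fun D hD => ?_
  have clique : (a ∈ D ∨ b ∈ D) ∧ (a ∈ D ∨ c ∈ D) ∧ (a ∈ D ∨ d ∈ D) ∧ (b ∈ D ∨ c ∈ D) ∧
      (b ∈ D ∨ d ∈ D) ∧ (c ∈ D ∨ d ∈ D) := by
    refine ⟨?_, ?_, ?_, ?_, ?_, ?_⟩ <;> apply hD.mem_or_mem <;> rw [mem_fourPathGraph] <;>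
      simp_all
  have merge : ∀ x y, x ∉ D → y ∈ D → x ≠ y → x ≠ v → y ≠ v →
      (∀ u w, (u, w) ∈ G → u ∉ insert v (D.erase y) → w ∉ insert v (D.erase y) →
        ((if u = y then x else u), (if w = y then x else w)) ∈ fourPathGraph G v a b c d) →
      ∃ E, IsDFVS G E ∧ E.card ≤ D.card := by
    intro x y hx hy hxy hxv hyv h
    refine ⟨insert v (D.erase y), IsDFVS.of_insert_of_merge (x := x) (y := y) ?_ ?_ hxy h, ?_⟩
    · exact hD.of_arcs (by grind)
    · grind
    · have := Finset.card_insert_le v (D.erase y)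
      have := Finset.card_erase_add_one hy
      omega
  by_cases ha : a ∈ D
  · by_cases hb : b ∈ D
    · by_cases hc : c ∈ D
      · by_cases hd : d ∈ D
        · exact ⟨D, hD.of_arcs fun u w huw hu hw => by
            rw [mem_fourPathGraph]; grind, le_rfl⟩
        · exact merge d a hd ha nad.symm nvd nva fun u w huw hu hw => by
            rw [mem_fourPathGraph]; grind
      · exact merge c a hc ha nac.symm nvc nva fun u w huw hu hw => by
          rw [mem_fourPathGraph]; grind
    · exact merge b d hb (by tauto) nbd nvb nvd fun u w huw hu hw => by
        rw [mem_fourPathGraph]; grind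
  · exact merge a d ha (by tauto) nad nva nvd fun u w huw hu hw => by
      rw [mem_fourPathGraph]; grind

lemma IsFourPath.le_dfvsNum {G : Dgraph V} {v a b c d : V} (h : IsFourPath G v a b c d)
    (hac : NoUncoveredPathBetween G a c) (had : NoUncoveredPathBetween G a d)
    (hdb : NoUncoveredPathBetween G d b) :
    dfvsNum (fourPathGraph G v a b c d) ≤ dfvsNum G := by
  obtain ⟨⟨⟨nab, nac, nad, nbc, nbd, ncd⟩, nva, nvb, nvc, nvd⟩, hbi, hnb, ⟨gab, gbc, gcd⟩,
    ⟨gac, gad, gbd⟩, gloop⟩ := h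
  refine dfvsNum_le_of_forall fun D hD => ?_
  by_cases hv : v ∈ D
  · have cover : (a ∈ D ∨ b ∈ D) ∧ (b ∈ D ∨ c ∈ D) ∧ (c ∈ D ∨ d ∈ D) :=
      ⟨hD.mem_or_mem gab.1 gab.2, hD.mem_or_mem gbc.1 gbc.2, hD.mem_or_mem gcd.1 gcd.2⟩
    have swap : ∀ y, IsDFVS (fourPathGraph G v a b c d) (insert y D) →
        ∃ E, IsDFVS (fourPathGraph G v a b c d) E ∧ E.card ≤ D.card := by
      intro y hy
      refine ⟨insert y (D.erase v), hy.of_arcs fun u w huw hu hw => ?_, ?_⟩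
      · have := (mem_fourPathGraph.1 huw).2
        grind
      · have := Finset.card_insert_le y (D.erase v)
        have := Finset.card_erase_add_one hv
        omega
    by_cases h₁ : b ∉ D ∧ d ∉ D
    · exact swap d (hD.insert_of_merge h₁.1 h₁.2 hdb.symm fun u w huw hu hw => by
        rw [mem_fourPathGraph] at huw; grind)
    by_cases h₂ : a ∉ D ∧ d ∉ D
    · exact swap d (hD.insert_of_merge h₂.1 h₂.2 had fun u w huw hu hw => by
        rw [mem_fourPathGraph] at huw; grind)
    by_cases h₃ : a ∉ D ∧ c ∉ D
    · exact swap a (hD.insert_of_merge h₃.2 h₃.1 hac.symm fun u w huw hu hw => by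
        rw [mem_fourPathGraph] at huw; grind)
    obtain ⟨z, hz⟩ : ∃ z, a ∈ insert z D ∧ b ∈ insert z D ∧ c ∈ insert z D ∧
        d ∈ insert z D := by
      by_cases ha : a ∈ D
      · by_cases hb : b ∈ D
        · by_cases hc : c ∈ D
          · exact ⟨d, by grind⟩
          · exact ⟨c, by grind⟩
        · exact ⟨b, by grind⟩
      · exact ⟨a, by grind⟩
    exact swap z (hD.fourPathGraph_of_subset (Finset.subset_insert z D) hz.1 hz.2.1
      hz.2.2.1 hz.2.2.2)
  · have mem : ∀ u, (u = a ∨ u = b ∨ u = c ∨ u = d) → u ∈ D := fun u hu =>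
      (hD.mem_or_mem (hbi u hu).1 (hbi u hu).2).resolve_right hv
    have ha := mem a (by simp)
    have hb := mem b (by simp)
    have hc := mem c (by simp)
    have hd := mem d (by simp)
    exact ⟨D, hD.fourPathGraph_of_subset subset_rfl ha hb hc hd, le_rfl⟩

/-- soundness of 4PATH. -/
theorem fourpath_sound (G : Dgraph V) (v a b c d : V)
    (hdist : ({a, b, c, d} : Finset V).card = 4)
    (hN : Nbhd G v = {a, b, c, d}) (hNbi : Nbi G v = {a, b, c, d})
    (hE : induce G {a, b, c, d} =
      ({(a, b), (b, a), (b, c), (c, b), (c, d), (d, c)} : Finset (V × V)))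
    (hac : NoUncoveredPathBetween G a c)
    (had : NoUncoveredPathBetween G a d)
    (hdb : NoUncoveredPathBetween G d b) :
    dfvsNum G = dfvsNum (fourPathGraph G v a b c d) := by
  obtain ⟨nab, nac, nad, nbc, nbd, ncd⟩ :
      a ≠ b ∧ a ≠ c ∧ a ≠ d ∧ b ≠ c ∧ b ≠ d ∧ c ≠ d := by
    refine ⟨?_, ?_, ?_, ?_, ?_, ?_⟩ <;> rintro rfl <;>
      · simp only [Finset.mem_insert, Finset.mem_singleton, true_or, or_true,
          Finset.insert_eq_of_mem] at hdist
        exact absurd (hdist.symm.trans_le Finset.card_le_three) (by norm_num)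
  have arcs : ∀ u w, (u = a ∨ u = b ∨ u = c ∨ u = d) → (w = a ∨ w = b ∨ w = c ∨ w = d) →
      ((u, w) ∈ G ↔ (u = a ∧ w = b) ∨ (u = b ∧ w = a) ∨ (u = b ∧ w = c) ∨ (u = c ∧ w = b) ∨
        (u = c ∧ w = d) ∨ (u = d ∧ w = c)) := by
    intro u w hu hw
    have := Finset.ext_iff.1 hE (u, w)
    simpa [induce, hu, hw] using this
  have hbi : ∀ u, (u = a ∨ u = b ∨ u = c ∨ u = d) → (u, v) ∈ G ∧ (v, u) ∈ G := by
    intro u hu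
    have := (Finset.ext_iff.1 hNbi u).2 (by simpa using hu)
    simpa [Nbi, Npre, Nsucc] using this
  have hnb : ∀ u, (u, v) ∈ G ∨ (v, u) ∈ G → u = a ∨ u = b ∨ u = c ∨ u = d := by
    intro u hu
    have := (Finset.ext_iff.1 hN u).1 (by simpa [Nbhd, Npre, Nsucc] using hu)
    simpa using this
  have nv : ∀ u, (u = a ∨ u = b ∨ u = c ∨ u = d) → u ≠ v := by
    rintro u hu rfl
    have := (arcs u u hu hu).1 (hbi u hu).1
    grind
  have nva := nv a (by simp)
  have nvb := nv b (by simp)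
  have nvc := nv c (by simp)
  have nvd := nv d (by simp)
  have gab : (a, b) ∈ G ∧ (b, a) ∈ G := by constructor <;> rw [arcs] <;> simp
  have gbc : (b, c) ∈ G ∧ (c, b) ∈ G := by constructor <;> rw [arcs] <;> simp
  have gcd : (c, d) ∈ G ∧ (d, c) ∈ G := by constructor <;> rw [arcs] <;> simp
  have gac : (a, c) ∉ G ∧ (c, a) ∉ G := by constructor <;> rw [arcs] <;> grind
  have gad : (a, d) ∉ G ∧ (d, a) ∉ G := by constructor <;> rw [arcs] <;> grind
  have gbd : (b, d) ∉ G ∧ (d, b) ∉ G := by constructor <;> rw [arcs] <;> grind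
  have gloop : (a, a) ∉ G ∧ (b, b) ∉ G ∧ (c, c) ∉ G ∧ (d, d) ∉ G := by
    refine ⟨?_, ?_, ?_, ?_⟩ <;> rw [arcs] <;> grind
  have h : IsFourPath G v a b c d :=
    ⟨⟨⟨nab, nac, nad, nbc, nbd, ncd⟩, nva, nvb, nvc, nvd⟩, hbi, hnb, ⟨gab, gbc, gcd⟩,
      ⟨gac, gad, gbd⟩, gloop⟩
  exact le_antisymm h.dfvsNum_le (h.le_dfvsNum hac had hdb)

end

end DFVSP
end

section
/- (Soundness of OUT0/1) Let G be a digraph and v ∈ V(G) a vertex with (v,v) ∉ E(G) and at most one outgoing arc, i.e., |N_succ(v)| ≤ 1. Then DFVS(G) = DFVS(G∘v), and every DFVS of G∘v is a DFVS of G. -/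
namespace DFVSP

open scoped Classical

noncomputable section

variable {V : Type*} [Fintype V] [DecidableEq V]

/-- The arcs of `G` both of whose endpoints avoid `D`. -/
def ArcAvoiding (G : Dgraph V) (D : Finset V) (a b : V) : Prop :=
  (a, b) ∈ G ∧ a ∉ D ∧ b ∉ D

theorem isDFVS_iff_forall_not_transGen {W : Type*} (G : Dgraph W) (D : Finset W) :
    IsDFVS G D ↔ ∀ x, ¬ Relation.TransGen (ArcAvoiding G D) x x := by
  constructor
  · intro h x hx
    obtain ⟨y, hxy, hyx⟩ := Relation.TransGen.head'_iff.mp hx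
    obtain ⟨l, hl, hlast⟩ := List.exists_isChain_cons_of_relationReflTransGen hyx
    have hchain : List.IsChain (ArcAvoiding G D) (x :: y :: l) :=
      List.IsChain.cons_cons hxy hl
    obtain ⟨z, hz, hzD⟩ := h (x :: y :: l)
      ⟨hchain.imp fun _ _ h => h.1, by simp, by
        rw [List.getLast?_cons_cons, List.getLast?_eq_getLast_of_ne_nil (by simp), hlast]; simp⟩
    have havoid : ∀ w ∈ y :: l, w ∉ D :=
      hl.induction (fun w => w ∉ D) (y :: l) (fun _ _ h _ => h.2.2) (fun _ => hxy.2.2)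
    rcases List.mem_cons.mp hz with rfl | hz
    · exact hxy.2.1 hzD
    · exact havoid z hz hzD
  · rintro h p ⟨hp, hlen, hends⟩
    by_contra! hD
    match p, hp, hlen, hends, hD with
    | a :: b :: l, hp, _, hends, hD =>
      have hchain : List.IsChain (ArcAvoiding G D) (a :: b :: l) :=
        List.IsChain.imp_of_mem_imp (fun x y hx hy hxy => ⟨hxy, hD x hx, hD y hy⟩) hp
      obtain ⟨hab, hbl⟩ := List.isChain_cons_cons.mp hchain
      have hlast : (b :: l).getLast (by simp) = a := by
        rw [List.getLast?_cons_cons, List.getLast?_eq_getLast_of_ne_nil (by simp)] at hends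
        simpa using hends.symm
      exact h a (Relation.TransGen.head' hab
        (List.relationReflTransGen_of_exists_isChain_cons l hbl hlast))

theorem mem_exclude {G : Dgraph V} {v a b : V} :
    (a, b) ∈ exclude G v ↔ ((a, b) ∈ G ∧ a ≠ v ∧ b ≠ v) ∨ ((a, v) ∈ G ∧ (v, b) ∈ G) := by
  simp [exclude, deleteVertex, Npre, Nsucc]

/-- A walk in `G` from `a ≠ v` shortcuts to a walk in `G ∘ v`, up to a last arc into `v`. -/
theorem transGen_exclude_of_transGen {G : Dgraph V} {v : V} (hloop : (v, v) ∉ G) {D : Finset V}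
    {a b : V} (ha : a ≠ v) (h : Relation.TransGen (ArcAvoiding G D) a b) :
    (b ≠ v → Relation.TransGen (ArcAvoiding (exclude G v) D) a b) ∧
      (b = v → ∃ p, Relation.ReflTransGen (ArcAvoiding (exclude G v) D) a p ∧
        ArcAvoiding G D p v) := by
  induction h with
  | single h =>
    refine ⟨fun hb => .single ⟨mem_exclude.mpr (.inl ⟨h.1, ha, hb⟩), h.2⟩, ?_⟩
    rintro rfl
    exact ⟨a, .refl, h⟩
  | @tail b c _ hbc ih =>
    by_cases hb : b = v
    · subst hb
      obtain ⟨p, hap, hp⟩ := ih.2 rfl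
      refine ⟨fun _ => .tail' hap ⟨mem_exclude.mpr (.inr ⟨hp.1, hbc.1⟩), hp.2.1, hbc.2.2⟩, ?_⟩
      rintro rfl
      exact absurd hbc.1 hloop
    · refine ⟨fun hc => (ih.1 hb).tail ⟨mem_exclude.mpr (.inl ⟨hbc.1, hb, hc⟩), hbc.2⟩, ?_⟩
      rintro rfl
      exact ⟨b, (ih.1 hb).to_reflTransGen, hbc⟩

theorem IsDFVS.of_exclude {G : Dgraph V} {v : V} (hloop : (v, v) ∉ G) {D : Finset V}
    (hD : IsDFVS (exclude G v) D) : IsDFVS G D := by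
  rw [isDFVS_iff_forall_not_transGen] at hD ⊢
  have key : ∀ x, x ≠ v → ¬ Relation.TransGen (ArcAvoiding G D) x x := fun x hx h =>
    hD x ((transGen_exclude_of_transGen hloop hx h).1 hx)
  intro x h
  by_cases hx : x = v
  · subst hx
    obtain ⟨y, hxy, hyx⟩ := Relation.TransGen.head'_iff.mp h
    refine key y ?_ (.tail' hyx hxy)
    rintro rfl
    exact hloop hxy.1
  · exact key x hx h

theorem IsDFVS.exclude_of_notMem {G : Dgraph V} {v : V} {D : Finset V} (hD : IsDFVS G D)
    (hv : v ∉ D) : IsDFVS (exclude G v) D := by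
  rw [isDFVS_iff_forall_not_transGen] at hD ⊢
  intro x h
  refine hD x (Relation.TransGen.lift' id (fun a b hab => ?_) x x h)
  rcases mem_exclude.mp hab.1 with h | h
  · exact .single ⟨h.1, hab.2⟩
  · exact .tail (.single ⟨h.1, hab.2.1, hv⟩) ⟨h.2, hv, hab.2.2⟩

theorem IsDFVS.exclude_erase_union_Nsucc {G : Dgraph V} {D : Finset V} (hD : IsDFVS G D)
    (v : V) : IsDFVS (exclude G v) (D.erase v ∪ Nsucc G v) := by
  rw [isDFVS_iff_forall_not_transGen] at hD ⊢
  intro x h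
  refine hD x (Relation.TransGen.mono (fun a b hab => ?_) x x h)
  obtain ⟨hG, ha, hb⟩ := hab
  simp only [Finset.mem_union, Finset.mem_erase, Nsucc, Finset.mem_filter, Finset.mem_univ,
    true_and, not_or, not_and] at ha hb
  rcases mem_exclude.mp hG with h | h
  · exact ⟨h.1, ha.1 h.2.1, hb.1 h.2.2⟩
  · exact absurd h.2 hb.2

theorem isDFVS_univ {W : Type*} [Fintype W] (G : Dgraph W) : IsDFVS G Finset.univ := by
  rw [isDFVS_iff_forall_not_transGen]
  intro x h
  obtain ⟨y, hxy, -⟩ := Relation.TransGen.head'_iff.mp h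
  exact hxy.2.1 (Finset.mem_univ x)

theorem dfvsNum_le {W : Type*} {G : Dgraph W} {D : Finset W} (hD : IsDFVS G D) :
    dfvsNum G ≤ D.card :=
  Nat.sInf_le ⟨D, hD, rfl⟩

theorem exists_isDFVS_card_eq_dfvsNum {W : Type*} [Fintype W] (G : Dgraph W) :
    ∃ D : Finset W, IsDFVS G D ∧ D.card = dfvsNum G :=
  Nat.sInf_mem (s := {n | ∃ D : Finset W, IsDFVS G D ∧ D.card = n})
    ⟨_, Finset.univ, isDFVS_univ G, rfl⟩

/-- soundness of OUT0/1. -/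
theorem out01_sound (G : Dgraph V) (v : V) (hloop : (v, v) ∉ G)
    (hout : (Nsucc G v).card ≤ 1) :
    dfvsNum G = dfvsNum (exclude G v) ∧
      ∀ D : Finset V, IsDFVS (exclude G v) D → IsDFVS G D := by
  refine ⟨le_antisymm ?_ ?_, fun D hD => hD.of_exclude hloop⟩
  · obtain ⟨D, hD, hcard⟩ := exists_isDFVS_card_eq_dfvsNum (exclude G v)
    exact hcard ▸ dfvsNum_le (hD.of_exclude hloop)
  · obtain ⟨D, hD, hcard⟩ := exists_isDFVS_card_eq_dfvsNum G
    rw [← hcard]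
    by_cases hv : v ∈ D
    · calc dfvsNum (exclude G v) ≤ (D.erase v ∪ Nsucc G v).card :=
            dfvsNum_le (hD.exclude_erase_union_Nsucc v)
        _ ≤ (D.erase v).card + (Nsucc G v).card := Finset.card_union_le _ _
        _ ≤ (D.erase v).card + 1 := by gcongr
        _ = D.card := Finset.card_erase_add_one hv
    · exact dfvsNum_le (hD.exclude_of_notMem hv)

end

end DFVSP
end

section
/- (Soundness of PIE) Let G be a digraph and (u,v) ∈ E(G) an arc with (v,u) ∉ E(G) such that every path from v to u in G uses a bi-edge. Then a set S ⊆ V(G) is a DFVS of G if and only if S is a DFVS of G − (u,v); in particular DFVS(G) = DFVS(G − (u,v)). -/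
namespace DFVSP

open scoped Classical

noncomputable section

variable {V : Type*} [Fintype V] [DecidableEq V]

theorem IsPath.mono {V : Type*} {G H : Dgraph V} (h : G ⊆ H) {p : List V} (hp : IsPath G p) :
    IsPath H p :=
  List.IsChain.imp (fun _ _ hab => h hab) hp

theorem IsDFVS.anti {V : Type*} {G H : Dgraph V} (h : G ⊆ H) {S : Finset V} (hS : IsDFVS H S) :
    IsDFVS G S :=
  fun p hp => hS p ⟨hp.1.mono h, hp.2⟩

/-- A path either avoids a given arc or traverses it. -/
theorem IsPath.erase_or_eq_append {V : Type*} [DecidableEq V] {G : Dgraph V} (u v : V)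
    {p : List V} (hp : IsPath G p) :
    IsPath (G.erase (u, v)) p ∨ ∃ l₁ l₂, p = l₁ ++ u :: v :: l₂ := by
  unfold IsPath at *
  induction p with
  | nil => exact Or.inl List.IsChain.nil
  | cons a t ih =>
    cases t with
    | nil => exact Or.inl (List.IsChain.singleton a)
    | cons b t =>
      obtain ⟨hab, ht⟩ := List.isChain_cons_cons.1 hp
      by_cases he : (a, b) = (u, v)
      · obtain ⟨rfl, rfl⟩ := Prod.mk.inj he
        exact Or.inr ⟨[], t, rfl⟩
      · rcases ih ht with h | ⟨l₁, l₂, h⟩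
        · exact Or.inl (List.isChain_cons_cons.2 ⟨Finset.mem_erase.2 ⟨he, hab⟩, h⟩)
        · exact Or.inr ⟨a :: l₁, l₂, by rw [h, List.cons_append]⟩

/-- A cycle through the arc `(u, v)` contains a path from `v` back to `u`. -/
theorem IsCycle.exists_isPathFrom {V : Type*} {G : Dgraph V} {u v : V} {l₁ l₂ : List V}
    (hp : IsCycle G (l₁ ++ u :: v :: l₂)) :
    ∃ q, IsPathFrom G v u q ∧ ∀ x ∈ q, x ∈ l₁ ++ u :: v :: l₂ := by
  obtain ⟨hpath, -, hends⟩ := hp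
  unfold IsPath at hpath
  obtain ⟨h₁, h₂⟩ := List.isChain_split.1 hpath
  have h₂ := (List.isChain_cons_cons.1 h₂).2
  cases l₁ with
  | nil =>
    refine ⟨v :: l₂, ⟨h₂, rfl, ?_⟩, fun x hx => List.mem_cons_of_mem _ hx⟩
    simpa using hends.symm
  | cons a t =>
    have hlast : (v :: l₂).getLast? = some a := by
      have hsplit : a :: t ++ u :: v :: l₂ = (a :: t ++ [u]) ++ v :: l₂ := by simp
      rw [hsplit, List.getLast?_append_of_ne_nil _ (List.cons_ne_nil v l₂)] at hends
      exact hends.symm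
    refine ⟨(v :: l₂) ++ (t ++ [u]), ⟨?_, rfl, ?_⟩, ?_⟩
    · refine List.isChain_append.2 ⟨h₂, (List.isChain_cons.1 h₁).2, ?_⟩
      intro x hx y hy
      rw [hlast, Option.mem_some_iff] at hx
      subst hx
      exact (List.isChain_cons.1 h₁).1 y hy
    · rw [← List.append_assoc, List.getLast?_concat]
    · intro x hx
      simp only [List.mem_append, List.mem_cons, List.not_mem_nil] at hx ⊢
      tauto

theorem isCycle_of_biEdge {V : Type*} {G : Dgraph V} {a b : V} (hab : (a, b) ∈ G)
    (hba : (b, a) ∈ G) : IsCycle G [a, b, a] :=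
  ⟨List.isChain_cons_cons.2 ⟨hab, List.isChain_pair.2 hba⟩, by simp, by simp⟩

theorem IsDFVS.of_erase {V : Type*} [DecidableEq V] {G : Dgraph V} {u v : V}
    (hvu : (v, u) ∉ G) (hpie : ∀ p : List V, IsPathFrom G v u p → UsesBiEdge G p)
    {S : Finset V} (hS : IsDFVS (G.erase (u, v)) S) : IsDFVS G S := by
  intro p hp
  rcases hp.1.erase_or_eq_append u v with h | ⟨l₁, l₂, rfl⟩
  · exact hS p ⟨h, hp.2⟩
  · obtain ⟨q, hq, hsub⟩ := hp.exists_isPathFrom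
    obtain ⟨⟨a, b⟩, hmem, hab, hba⟩ := hpie q hq
    obtain ⟨ha, hb⟩ := List.of_mem_zip hmem
    have hb := List.mem_of_mem_tail hb
    have hab' : (a, b) ∈ G.erase (u, v) := by
      refine Finset.mem_erase.2 ⟨?_, hab⟩
      rintro ⟨⟩
      exact hvu hba
    have hba' : (b, a) ∈ G.erase (u, v) := by
      refine Finset.mem_erase.2 ⟨?_, hba⟩
      rintro ⟨⟩
      exact hvu hab
    obtain ⟨x, hx, hxS⟩ := hS _ (isCycle_of_biEdge hab' hba')
    refine ⟨x, hsub x ?_, hxS⟩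
    simp only [List.mem_cons, List.not_mem_nil, or_false] at hx
    rcases hx with rfl | rfl | rfl <;> assumption

/-- soundness of PIE. -/
theorem pie_sound (G : Dgraph V) (u v : V)
    (huv : (u, v) ∈ G) (hvu : (v, u) ∉ G)
    (hpie : ∀ p : List V, IsPathFrom G v u p → UsesBiEdge G p) :
    (∀ S : Finset V, IsDFVS G S ↔ IsDFVS (G.erase (u, v)) S) ∧
      dfvsNum G = dfvsNum (G.erase (u, v)) := by
  have h : ∀ S : Finset V, IsDFVS G S ↔ IsDFVS (G.erase (u, v)) S := fun S =>
    ⟨fun hS => hS.anti (Finset.erase_subset _ _), fun hS => hS.of_erase hvu hpie⟩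
  exact ⟨h, by simp only [dfvsNum, h]⟩

end

end DFVSP
end
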